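/- arXiv:2305.10137 — 5 statements merged into one kernel-verified Lean document; each statement's English description precedes it below -/
import Mathlib

section
/- Let d be a natural number and σ a permutation of Fin d. For each i with 1 ≤ i ≤ d let N_i denote the number of orbits of the cyclic subgroup generated by σ on Fin d having exactly i elements. Then the centralizer of σ in Equiv.Perm (Fin d) is isomorphic as a group to the direct product over i ∈ {1, …, d} of the wreath products (ℤ/iℤ) ≀ S_{N_i}, i.e. of the semidirect products (Fin N_i → Multiplicative (ZMod i)) ⋊ Equiv.Perm (Fin N_i) with Equiv.Perm (Fin N_i) permuting coordinates. -/
/-- The coordinate-permutation action of `S_b` on `(Fin b → G)`. -/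
def permuteCoords (G : Type*) [Group G] (b : ℕ) :
    Equiv.Perm (Fin b) →* MulAut (Fin b → G) where
  toFun τ :=
    { toFun := fun f => f ∘ ⇑τ.symm
      invFun := fun f => f ∘ ⇑τ
      left_inv := fun f => by funext i; simp
      right_inv := fun f => by funext i; simp
      map_mul' := fun f h => rfl }
  map_one' := MulEquiv.ext fun f => rfl
  map_mul' := fun τ σ => MulEquiv.ext fun f => rfl

/-- The wreath product `G ≀ S_b`: the semidirect product
`(Fin b → G) ⋊ Equiv.Perm (Fin b)` with `S_b` permuting the coordinates. -/
abbrev WreathProduct (G : Type*) [Group G] (b : ℕ) : Type _ :=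
  (Fin b → G) ⋊[permuteCoords G b] Equiv.Perm (Fin b)

/-!
STATEMENT 5: Let `σ` be a permutation of `Fin d`, and for `1 ≤ i ≤ d` let `N_i` be the
number of orbits of `⟨σ⟩` on `Fin d` of cardinality exactly `i`.  Then the centralizer
of `σ` in `S_d` is isomorphic to the direct product over `i ∈ {1, …, d}` of the wreath
products `(ℤ/iℤ) ≀ S_{N_i}`.
-/

/-- The model set. -/
abbrev CW.X (d : ℕ) (M : ℕ → ℕ) : Type := Σ i : Fin d, Fin (M (i.1 + 1)) × ZMod (i.1 + 1)

/-- The shift on the model set. -/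
def CW.shift (d : ℕ) (M : ℕ → ℕ) : Equiv.Perm (CW.X d M) where
  toFun x := ⟨x.1, x.2.1, x.2.2 + 1⟩
  invFun x := ⟨x.1, x.2.1, x.2.2 - 1⟩
  left_inv := by rintro ⟨i, k, z⟩; simp
  right_inv := by rintro ⟨i, k, z⟩; simp

theorem CW.shift_pow (d : ℕ) (M : ℕ → ℕ) (n : ℕ) (i : Fin d) (k : Fin (M (i.1 + 1)))
    (z : ZMod (i.1 + 1)) : (CW.shift d M ^ n) ⟨i, k, z⟩ = ⟨i, k, z + n⟩ := by
  induction n with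
  | zero => simp
  | succ n ih =>
    rw [pow_succ', Equiv.Perm.mul_apply, ih]
    simp [CW.shift, add_assoc]

theorem CW.shift_pow_eq_iff (d : ℕ) (M : ℕ → ℕ) (n : ℕ) (x : CW.X d M) :
    (CW.shift d M ^ n) x = x ↔ x.1.1 + 1 ∣ n := by
  obtain ⟨i, k, z⟩ := x
  rw [CW.shift_pow]
  simp [ZMod.natCast_eq_zero_iff]

/-- The action of the product of wreath products on the model set. -/
def CW.act (d : ℕ) (M : ℕ → ℕ) :
    (∀ i : Fin d, WreathProduct (Multiplicative (ZMod (i.1 + 1))) (M (i.1 + 1))) →*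
      Equiv.Perm (CW.X d M) :=
  MonoidHom.toHomPerm
  { toFun := fun g x => ⟨x.1, (g x.1).right x.2.1,
      ((g x.1).left ((g x.1).right x.2.1)).toAdd + x.2.2⟩
    map_one' := by
      funext x
      obtain ⟨i, k, z⟩ := x
      simp
      rfl
    map_mul' := fun g h => by
      funext x
      obtain ⟨i, k, z⟩ := x
      simp [permuteCoords, add_assoc]
      rfl }

theorem CW.act_apply (d : ℕ) (M : ℕ → ℕ)
    (g : ∀ i : Fin d, WreathProduct (Multiplicative (ZMod (i.1 + 1))) (M (i.1 + 1)))
    (i : Fin d) (k : Fin (M (i.1 + 1))) (z : ZMod (i.1 + 1)) :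
    CW.act d M g ⟨i, k, z⟩ = ⟨i, (g i).right k, ((g i).left ((g i).right k)).toAdd + z⟩ := rfl

theorem CW.act_injective (d : ℕ) (M : ℕ → ℕ) : Function.Injective (CW.act d M) := by
  intro g h hgh
  have key : ∀ i k, (g i).right k = (h i).right k ∧
      (g i).left ((g i).right k) = (h i).left ((h i).right k) := by
    intro i k
    have := congrArg (fun p : Equiv.Perm (CW.X d M) => p ⟨i, k, 0⟩) hgh
    simp only [CW.act_apply] at this
    simpa using this
  funext i
  have hr : (g i).right = (h i).right := Equiv.ext fun k => (key i k).1
  refine SemidirectProduct.ext ?_ hr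
  funext k
  have := (key i ((g i).right.symm k)).2
  rw [← hr] at this
  simpa using this

theorem CW.act_range (d : ℕ) (M : ℕ → ℕ) :
    (CW.act d M).range = Subgroup.centralizer {CW.shift d M} := by
  ext τ
  rw [Subgroup.mem_centralizer_singleton_iff]
  constructor
  · rintro ⟨g, rfl⟩
    ext1 x
    obtain ⟨i, k, z⟩ := x
    simp only [Equiv.Perm.mul_apply, CW.act_apply]
    simp [CW.shift, CW.act_apply, add_assoc]
  · intro h
    have hc : Commute τ (CW.shift d M) := h
    have hp : ∀ n x, τ ((CW.shift d M ^ n) x) = (CW.shift d M ^ n) (τ x) := fun n x =>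
      congrArg (fun p : Equiv.Perm (CW.X d M) => p x) (hc.pow_right n).eq
    have hi : ∀ x, (τ x).1 = x.1 := by
      intro x
      have : ∀ n, (τ x).1.1 + 1 ∣ n ↔ x.1.1 + 1 ∣ n := by
        intro n
        rw [← CW.shift_pow_eq_iff, ← CW.shift_pow_eq_iff, ← hp, τ.injective.eq_iff]
      have := Nat.dvd_antisymm ((this _).2 dvd_rfl) ((this _).1 dvd_rfl)
      exact Fin.ext (by omega)
    have h0 : ∀ i k, ∃ q : Fin (M (i.1 + 1)) × ZMod (i.1 + 1), τ ⟨i, k, 0⟩ = ⟨i, q⟩ := by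
      intro i k
      have := hi ⟨i, k, 0⟩
      generalize τ ⟨i, k, 0⟩ = y at this
      obtain ⟨j, q⟩ := y
      obtain rfl : j = i := this
      exact ⟨q, rfl⟩
    choose q hq using h0
    have hz : ∀ i k z, τ ⟨i, k, z⟩ = ⟨i, (q i k).1, (q i k).2 + z⟩ := by
      intro i k z
      have h1 := hp z.val ⟨i, k, 0⟩
      rw [hq, CW.shift_pow] at h1
      rw [← Prod.mk.eta (p := q i k), CW.shift_pow] at h1
      simpa using h1
    have hinj : ∀ i, Function.Injective fun k => (q i k).1 := by
      intro i k l hkl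
      have : τ ⟨i, k, -(q i k).2⟩ = τ ⟨i, l, -(q i l).2⟩ := by
        rw [hz, hz]
        simpa using hkl
      have := τ.injective this
      simp at this
      exact this.1
    let ρ : ∀ i : Fin d, Equiv.Perm (Fin (M (i.1 + 1))) := fun i =>
      Equiv.ofBijective _ (Finite.injective_iff_bijective.1 (hinj i))
    have hρ : ∀ i k, ρ i k = (q i k).1 := fun i k => rfl
    refine ⟨fun i => ⟨fun k => Multiplicative.ofAdd (q i ((ρ i).symm k)).2, ρ i⟩, ?_⟩
    ext1 x
    obtain ⟨i, k, z⟩ := x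
    rw [CW.act_apply, hz]
    simp [hρ]
    exact congrArg (fun l => (q i l).2) ((ρ i).symm_apply_apply k)

theorem CW.iso (d : ℕ) (M : ℕ → ℕ) (σ : Equiv.Perm (Fin d)) (F : CW.X d M ≃ Fin d)
    (hF : ∀ x, F (CW.shift d M x) = σ (F x)) :
    Nonempty ((Subgroup.centralizer {σ} : Subgroup (Equiv.Perm (Fin d))) ≃*
      ∀ i : Fin d, WreathProduct (Multiplicative (ZMod (i.1 + 1))) (M (i.1 + 1))) := by
  have e1 := MonoidHom.ofInjective (CW.act_injective d M)
  have e2 := MulEquiv.subgroupCongr (CW.act_range d M)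
  have hs : F.permCongrHom (CW.shift d M) = σ := by
    ext1 x
    simp [Equiv.permCongrHom, Equiv.permCongr_apply, hF]
  have e3 := F.permCongrHom.subgroupMap (Subgroup.centralizer {CW.shift d M})
  have e4 : (Subgroup.centralizer {CW.shift d M}).map F.permCongrHom.toMonoidHom =
      Subgroup.centralizer {σ} := by
    ext τ
    rw [Subgroup.mem_map_equiv, Subgroup.mem_centralizer_singleton_iff,
      Subgroup.mem_centralizer_singleton_iff, ← F.permCongrHom.injective.eq_iff]
    rw [map_mul, map_mul, hs, MulEquiv.apply_symm_apply]
  exact ⟨((e1.trans e2).trans (e3.trans (MulEquiv.subgroupCongr e4))).symm⟩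

theorem centralizer_iso_product_of_wreath_products (d : ℕ) (σ : Equiv.Perm (Fin d))
    (N : ℕ → ℕ)
    (hN : ∀ i : ℕ, N i = Nat.card
      {ω : MulAction.orbitRel.Quotient (Subgroup.zpowers σ) (Fin d) //
        Nat.card ω.orbit = i}) :
    Nonempty ((Subgroup.centralizer {σ} : Subgroup (Equiv.Perm (Fin d))) ≃*
      ∀ i : Fin d, WreathProduct (Multiplicative (ZMod (i.1 + 1))) (N (i.1 + 1))) := by
  have e : ∀ i : ℕ, Fin (N i) ≃
      {ω : MulAction.orbitRel.Quotient (Subgroup.zpowers σ) (Fin d) //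
        Nat.card ω.orbit = i} := fun i =>
    (finCongr (hN i)).trans (Finite.equivFin _).symm
  have hper : ∀ ω : MulAction.orbitRel.Quotient (Subgroup.zpowers σ) (Fin d),
      Function.minimalPeriod σ ω.out = Nat.card ω.orbit := by
    intro ω
    rw [MulAction.orbitRel.Quotient.orbit_eq_orbit_out ω Quotient.out_eq']
    have := Fintype.ofFinite (MulAction.orbit (Subgroup.zpowers σ) ω.out)
    rw [Nat.card_eq_fintype_card, ← MulAction.minimalPeriod_eq_card]
    rfl
  have hmk : ∀ (n : ℕ) (ω : MulAction.orbitRel.Quotient (Subgroup.zpowers σ) (Fin d)),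
      (Quotient.mk'' (σ^[n] ω.out) :
        MulAction.orbitRel.Quotient (Subgroup.zpowers σ) (Fin d)) = ω := by
    intro n ω
    conv_rhs => rw [← Quotient.out_eq' ω]
    apply Quotient.sound'
    rw [MulAction.orbitRel_apply]
    refine ⟨⟨σ ^ n, n, by simp⟩, ?_⟩
    change (σ ^ n) ω.out = _
    rw [Equiv.Perm.iterate_eq_pow]
  let F : CW.X d N → Fin d := fun x => σ^[x.2.2.val] (e _ x.2.1).1.out
  have hF : ∀ x, F (CW.shift d N x) = σ (F x) := by
    rintro ⟨i, k, z⟩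
    change σ^[(z + 1).val] (e _ k).1.out = σ (σ^[z.val] (e _ k).1.out)
    have hp := (hper (e _ k).1).trans (e _ k).2
    rw [← Function.iterate_succ_apply' σ, ← Function.iterate_mod_minimalPeriod_eq (n := z.val.succ),
      hp, ← ZMod.val_natCast]
    simp
  have hinj : Function.Injective F := by
    rintro ⟨i, k, z⟩ ⟨j, l, w⟩ h
    change σ^[z.val] (e _ k).1.out = σ^[w.val] (e _ l).1.out at h
    have h1 : (e _ k).1 = (e _ l).1 := by
      rw [← hmk z.val (e _ k).1, h, hmk]
    have h2 : i = j := by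
      have := (e _ k).2
      rw [h1, (e _ l).2] at this
      exact Fin.ext (by omega)
    subst h2
    have h3 : k = l := (e _).injective (Subtype.ext h1)
    subst h3
    have hp := (hper (e _ k).1).trans (e _ k).2
    have h4 := (Function.iterate_eq_iterate_iff_of_lt_minimalPeriod
      (by rw [hp]; exact ZMod.val_lt z) (by rw [hp]; exact ZMod.val_lt w)).1 h
    rw [ZMod.val_injective _ h4]
  have hsurj : Function.Surjective F := by
    intro x
    set ω : MulAction.orbitRel.Quotient (Subgroup.zpowers σ) (Fin d) := Quotient.mk'' x with hω
    have hx : x ∈ MulAction.orbit (Subgroup.zpowers σ) ω.out := by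
      rw [← MulAction.orbitRel_apply]
      exact Quotient.exact' (by rw [Quotient.out_eq'])
    obtain ⟨⟨g, hg⟩, hgx⟩ := hx
    change g ω.out = x at hgx
    obtain ⟨m, rfl⟩ := (mem_zpowers_iff_mem_range_orderOf.trans Finset.mem_image).1 hg |>.imp
      fun _ h => h.2
    have hpos : 0 < Nat.card ω.orbit := by
      have : Nonempty ω.orbit :=
        ⟨x, MulAction.orbitRel.Quotient.mem_orbit.2 rfl⟩
      exact Nat.card_pos
    have hle : Nat.card ω.orbit ≤ d := by
      simpa using Nat.card_le_card_of_injective (Subtype.val : ω.orbit → Fin d)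
        Subtype.val_injective
    obtain ⟨i, hi⟩ : ∃ i : Fin d, Nat.card ω.orbit = i.1 + 1 :=
      ⟨⟨Nat.card ω.orbit - 1, by omega⟩, by
        change _ = Nat.card ω.orbit - 1 + 1
        omega⟩
    refine ⟨⟨i, (e _).symm ⟨ω, hi⟩, (m : ZMod (i.1 + 1))⟩, ?_⟩
    change σ^[(m : ZMod (i.1 + 1)).val] (e _ ((e _).symm ⟨ω, hi⟩)).1.out = x
    rw [Equiv.apply_symm_apply, ZMod.val_natCast]
    change σ^[m % (i.1 + 1)] ω.out = x
    rw [← hi, ← hper,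
      Function.iterate_mod_minimalPeriod_eq, Equiv.Perm.iterate_eq_pow, hgx]
  exact CW.iso d N σ (Equiv.ofBijective F ⟨hinj, hsurj⟩) hF
end

section
/- Let R be a commutative ring, and let G ∈ MvPolynomial (Fin n) R and H ∈ MvPolynomial (Fin m) R. Let F ∈ MvPolynomial (Fin n ⊕ Fin m) R be the product of the images of G and H under the variable-renaming maps along Sum.inl and Sum.inr. Then the inclusion–exclusion numerator of F equals the product of the images of the inclusion–exclusion numerators of G and of H: N(F) = rename(inl)(N(G)) · rename(inr)(N(H)). Consequently, the paper's difference operator satisfies δ(G·H) = δ(G)·δ(H) for polynomials in disjoint sets of variables. -/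
/-- The inclusion–exclusion numerator `N(F) = Σ_{S ⊆ vars} (−1)^{|S|} · F[xᵢ := 1 for i ∈ S]`,
the alternating sum over subsets of the variables of the result of substituting `1` for the
variables in `S`.  The paper's difference operator is `δ(F) = N(F) / ∏ᵢ (1 − xᵢ)`. -/
noncomputable def ieNumerator {R : Type*} [CommRing R] {ι : Type*} [Fintype ι] [DecidableEq ι]
    (F : MvPolynomial ι R) : MvPolynomial ι R :=
  ∑ S : Finset ι, (-1 : MvPolynomial ι R) ^ S.card *
    MvPolynomial.aeval (fun i => if i ∈ S then 1 else MvPolynomial.X i) F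

/-!
STATEMENT 7: For polynomials `G`, `H` in disjoint sets of variables, the
inclusion–exclusion numerator of their product is the product of their
inclusion–exclusion numerators: `N(F) = rename(inl)(N(G)) · rename(inr)(N(H))` where
`F = rename(inl)(G) · rename(inr)(H)`.  Consequently the paper's difference operator
satisfies `δ(G·H) = δ(G)·δ(H)` for polynomials in disjoint sets of variables.
-/

theorem ieNumerator_mul_disjoint_vars {R : Type*} [CommRing R] {n m : ℕ}
    (G : MvPolynomial (Fin n) R) (H : MvPolynomial (Fin m) R) :
    ieNumerator ((MvPolynomial.rename Sum.inl G) * (MvPolynomial.rename Sum.inr H)) =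
      (MvPolynomial.rename (Sum.inl : Fin n → Fin n ⊕ Fin m) (ieNumerator G)) *
      (MvPolynomial.rename (Sum.inr : Fin m → Fin n ⊕ Fin m) (ieNumerator H)) := by
  unfold ieNumerator
  rw [map_sum, map_sum, Finset.sum_mul_sum, ← Finset.sum_product', Finset.univ_product_univ]
  refine Fintype.sum_equiv (Finset.sumEquiv (α := Fin n) (β := Fin m)).toEquiv _ _ ?_
  intro S
  obtain ⟨⟨A, B⟩, rfl⟩ := (Finset.sumEquiv (α := Fin n) (β := Fin m)).symm.surjective S
  have hG : MvPolynomial.aeval (fun i : Fin n ⊕ Fin m => if i ∈ A.disjSum B then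
      (1 : MvPolynomial (Fin n ⊕ Fin m) R) else MvPolynomial.X i)
      (MvPolynomial.rename Sum.inl G) = MvPolynomial.rename Sum.inl
        (MvPolynomial.aeval (fun i => if i ∈ A then 1 else MvPolynomial.X i) G) := by
    rw [MvPolynomial.aeval_rename, ← AlgHom.comp_apply, MvPolynomial.comp_aeval]
    congr 2
    funext i
    by_cases h : i ∈ A <;> simp [h]
  have hH : MvPolynomial.aeval (fun i : Fin n ⊕ Fin m => if i ∈ A.disjSum B then
      (1 : MvPolynomial (Fin n ⊕ Fin m) R) else MvPolynomial.X i)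
      (MvPolynomial.rename Sum.inr H) = MvPolynomial.rename Sum.inr
        (MvPolynomial.aeval (fun i => if i ∈ B then 1 else MvPolynomial.X i) H) := by
    rw [MvPolynomial.aeval_rename, ← AlgHom.comp_apply, MvPolynomial.comp_aeval]
    congr 2
    funext i
    by_cases h : i ∈ B <;> simp [h]
  have hS : (Finset.sumEquiv (α := Fin n) (β := Fin m)).symm (A, B) = A.disjSum B := rfl
  have hT : (Finset.sumEquiv (α := Fin n) (β := Fin m)).toEquiv (A.disjSum B) = (A, B) :=
    (Finset.sumEquiv (α := Fin n) (β := Fin m)).apply_symm_apply (A, B)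
  rw [hS, hT, map_mul, hG, hH, Finset.card_disjSum, pow_add]
  simp only [map_mul, map_pow, map_neg, map_one]
  ring
end

section
/- Let R be a commutative ring, n a natural number, and F ∈ MvPolynomial (Fin n) R. Then the product ∏_{i=1}^{n} (1 − x_i) divides the inclusion–exclusion numerator N(F) in MvPolynomial (Fin n) R. Hence the paper's difference operator δ(F) = N(F) / ∏_{i=1}^n (1 − x_i) is itself a polynomial. -/
/-!
STATEMENT 8: For any `F ∈ MvPolynomial (Fin n) R`, the product `∏ᵢ (1 − xᵢ)` divides the
inclusion–exclusion numerator `N(F)`; hence the paper's difference operator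
`δ(F) = N(F) / ∏ᵢ (1 − xᵢ)` is itself a polynomial.
-/

theorem prod_one_sub_X_dvd_ieNumerator {R : Type*} [CommRing R] (n : ℕ)
    (F : MvPolynomial (Fin n) R) :
    (∏ i : Fin n, (1 - MvPolynomial.X i)) ∣ ieNumerator F := by
  induction F using MvPolynomial.induction_on' with
  | monomial m a =>
    have h : ieNumerator (MvPolynomial.monomial m a) =
        MvPolynomial.C a * ∏ i : Fin n, ((-1 : MvPolynomial (Fin n) R)
          + MvPolynomial.X i ^ m i) := by
      rw [Finset.prod_add, Finset.mul_sum, Finset.powerset_univ]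
      unfold ieNumerator
      refine Finset.sum_congr rfl fun S _ => ?_
      have e : (m.prod fun i k =>
          (if i ∈ S then (1 : MvPolynomial (Fin n) R) else MvPolynomial.X i) ^ k) =
          ∏ i ∈ Finset.univ \ S, MvPolynomial.X i ^ m i := by
        rw [Finsupp.prod_fintype _ _ (fun i => pow_zero _),
          ← Finset.prod_sdiff (Finset.subset_univ S)]
        rw [Finset.prod_eq_one (s := S) (fun i hi => by simp [hi]), mul_one]
        refine Finset.prod_congr rfl fun i hi => ?_
        rw [if_neg (Finset.mem_sdiff.mp hi).2]
      rw [MvPolynomial.aeval_monomial, e, Finset.prod_const, MvPolynomial.algebraMap_eq]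
      ring
    rw [h]
    refine Dvd.dvd.mul_left (Finset.prod_dvd_prod_of_dvd _ _ fun i _ => ?_) _
    have h1 := sub_dvd_pow_sub_pow (1 : MvPolynomial (Fin n) R) (MvPolynomial.X i) (m i)
    rw [one_pow, ← dvd_neg, neg_sub] at h1
    rwa [neg_add_eq_sub]
  | add p q hp hq =>
    have h : ieNumerator (p + q) = ieNumerator p + ieNumerator q := by
      simp only [ieNumerator, map_add, mul_add, Finset.sum_add_distrib]
    rw [h]
    exact dvd_add hp hq
end

section
/- Let R be a commutative ring, P ∈ R[T] a polynomial in one variable, and r ≥ 1 a natural number. In the quotient of the polynomial ring R[a_1, …, a_r, x_1, …, x_r] by the ideal generated by the elements x_i² − (1 − a_i)·x_i for i = 1, …, r, the following identity holds: (∏_{i=1}^r (1 − a_i)) · Σ_{S ⊆ {1,…,r}} (−1)^{r−|S|} P(∏_{i∈S} (1 − x_i)) = (Σ_{S ⊆ {1,…,r}} (−1)^{r−|S|} P(∏_{i∈S} a_i)) · ∏_{i=1}^r x_i, where empty products equal 1. -/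
/-!
STATEMENT 10: Let `P ∈ R[T]` and `r ≥ 1`.  In the quotient of
`R[a_1, …, a_r, x_1, …, x_r]` by the ideal generated by `x_i² − (1 − a_i)·x_i`, one has
`(∏ᵢ (1 − aᵢ)) · Σ_{S ⊆ {1,…,r}} (−1)^{r−|S|} P(∏_{i∈S} (1 − xᵢ))
  = (Σ_{S ⊆ {1,…,r}} (−1)^{r−|S|} P(∏_{i∈S} aᵢ)) · ∏ᵢ xᵢ`,
where empty products equal `1`.  Here `aᵢ = X (inl i)` and `xᵢ = X (inr i)` in
`MvPolynomial (Fin r ⊕ Fin r) R`.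
-/

lemma strata_aux_one {B : Type*} [CommRing B] (a x : B) (h : x ^ 2 = (1 - a) * x) (n : ℕ) :
    (1 - a) * ((1 - x) ^ n - 1) = (a ^ n - 1) * x := by
  have hx : ∀ n : ℕ, (1 - x) ^ n * x = a ^ n * x := by
    intro n
    induction n with
    | zero => simp
    | succ k ih =>
      calc (1 - x) ^ (k + 1) * x = (1 - x) * ((1 - x) ^ k * x) := by ring
        _ = a ^ k * (x - x ^ 2) := by rw [ih]; ring
        _ = a ^ (k + 1) * x := by rw [h]; ring
  induction n with
  | zero => simp
  | succ k ih =>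
    calc (1 - a) * ((1 - x) ^ (k + 1) - 1)
        = (1 - a) * ((1 - x) ^ k - 1) - (1 - a) * ((1 - x) ^ k * x) := by ring
      _ = (a ^ (k + 1) - 1) * x := by rw [ih, hx]; ring

lemma strata_aux_sum {B : Type*} [CommRing B] {r : ℕ} (y : Fin r → B) (n : ℕ) :
    ∑ S : Finset (Fin r), (-1 : B) ^ (r - S.card) * (∏ i ∈ S, y i) ^ n =
      ∏ i, (y i ^ n - 1) := by
  simp only [sub_eq_add_neg]
  rw [Finset.prod_add, Finset.powerset_univ]
  refine Finset.sum_congr rfl fun S _ => ?_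
  rw [Finset.prod_const, Finset.prod_pow, ← Finset.compl_eq_univ_sdiff, Finset.card_compl,
    Fintype.card_fin, mul_comm]

lemma strata_aux {R B : Type*} [CommRing R] [CommRing B] [Algebra R B] (P : Polynomial R)
    {r : ℕ} (a x : Fin r → B) (h : ∀ i, x i ^ 2 = (1 - a i) * x i) :
    (∏ i, (1 - a i)) * (∑ S : Finset (Fin r), (-1 : B) ^ (r - S.card) *
          Polynomial.aeval (∏ i ∈ S, (1 - x i)) P) =
      (∑ S : Finset (Fin r), (-1 : B) ^ (r - S.card) *
          Polynomial.aeval (∏ i ∈ S, a i) P) * ∏ i, x i := by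
  induction P using Polynomial.induction_on' with
  | add p q hp hq =>
    simp only [map_add, mul_add, Finset.sum_add_distrib, add_mul]
    rw [hp, hq]
  | monomial n c =>
    simp only [Polynomial.aeval_monomial, mul_left_comm _ (algebraMap R B c)]
    rw [← Finset.mul_sum, ← Finset.mul_sum, strata_aux_sum, strata_aux_sum, mul_left_comm,
      mul_assoc, ← Finset.prod_mul_distrib, ← Finset.prod_mul_distrib]
    congr 1
    exact Finset.prod_congr rfl fun i _ => strata_aux_one _ _ (h i) n

theorem strata_coefficient_identity {R : Type*} [CommRing R] (P : Polynomial R)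
    (r : ℕ) (hr : 1 ≤ r) :
    let A := MvPolynomial (Fin r ⊕ Fin r) R
    let a : Fin r → A := fun i => MvPolynomial.X (Sum.inl i)
    let x : Fin r → A := fun i => MvPolynomial.X (Sum.inr i)
    let I : Ideal A := Ideal.span (Set.range fun i : Fin r => x i ^ 2 - (1 - a i) * x i)
    let q : A →+* A ⧸ I := Ideal.Quotient.mk I
    q (∏ i : Fin r, (1 - a i)) *
        (∑ S : Finset (Fin r), (-1 : A ⧸ I) ^ (r - S.card) *
          Polynomial.aeval (q (∏ i ∈ S, (1 - x i))) P) =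
      (∑ S : Finset (Fin r), (-1 : A ⧸ I) ^ (r - S.card) *
          Polynomial.aeval (q (∏ i ∈ S, a i)) P) *
        q (∏ i : Fin r, x i) := by
  intro A a x I q
  have h : ∀ i, q (x i) ^ 2 = (1 - q (a i)) * q (x i) := by
    intro i
    have hm : q (x i ^ 2 - (1 - a i) * x i) = 0 :=
      Ideal.Quotient.eq_zero_iff_mem.mpr (Ideal.subset_span ⟨i, rfl⟩)
    rw [map_sub, map_mul, map_sub, map_pow, map_one] at hm
    exact sub_eq_zero.mp hm
  have := strata_aux P (fun i => q (a i)) (fun i => q (x i)) h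
  simpa only [map_prod, map_sub, map_one] using this
end

section
/- Let X be a type and g, k natural numbers. Let the wreath product S_g ≀ S_k act on the function type Fin g × Fin k → X via the embedding Φ : S_g ≀ S_k → Equiv.Perm (Fin g × Fin k), Φ(f, τ)(a, i) = (f(τ i) a, τ i), with w • F := F ∘ Φ(w)⁻¹. Then the quotient of (Fin g × Fin k → X) by this action is in bijection with Sym (Sym X g) k, the k-th symmetric power of the g-th symmetric power of X (multisets of size k of multisets of size g of elements of X). -/
/-- The embedding `Φ : S_g ≀ S_k →* Equiv.Perm (Fin g × Fin k)`,
`Φ(f, τ)(a, i) = (f(τ i) a, τ i)`. -/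
def wreathToPerm (g k : ℕ) :
    WreathProduct (Equiv.Perm (Fin g)) k →* Equiv.Perm (Fin g × Fin k) where
  toFun w :=
    { toFun := fun p => (w.left (w.right p.2) p.1, w.right p.2)
      invFun := fun p => ((w.left p.2)⁻¹ p.1, w.right⁻¹ p.2)
      left_inv := fun p => by simp
      right_inv := fun p => by simp }
  map_one' := by
    ext p
    · rfl
    · rfl
  map_mul' := fun w v => by
    ext p
    · simp [SemidirectProduct.mul_left, SemidirectProduct.mul_right, permuteCoords]
    · simp [SemidirectProduct.mul_right]

/-- The action of the wreath product `S_g ≀ S_k` on `Fin g × Fin k → X` given by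
`w • F = F ∘ Φ(w)⁻¹`. -/
def wreathArrowAction (X : Type*) (g k : ℕ) :
    MulAction (WreathProduct (Equiv.Perm (Fin g)) k) (Fin g × Fin k → X) where
  smul w F := F ∘ ⇑(wreathToPerm g k w)⁻¹
  one_smul F := by
    show F ∘ ⇑(wreathToPerm g k 1)⁻¹ = F
    funext p
    simp
  mul_smul w v F := by
    show F ∘ ⇑(wreathToPerm g k (w * v))⁻¹ =
      (F ∘ ⇑(wreathToPerm g k v)⁻¹) ∘ ⇑(wreathToPerm g k w)⁻¹
    funext p
    simp [map_mul]

/-- The multiset of values of a tuple. -/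
def tupleSym {α : Type*} (n : ℕ) (f : Fin n → α) : Sym α n :=
  ⟨Multiset.map f Finset.univ.val, by simp⟩

theorem tupleSym_surjective {α : Type*} (n : ℕ) :
    Function.Surjective (tupleSym (α := α) n) := by
  rintro ⟨s, hs⟩
  induction s using Quotient.inductionOn with
  | h l =>
    have hl : l.length = n := by simpa using hs
    subst hl
    refine ⟨l.get, Subtype.ext ?_⟩
    simp [tupleSym, Fin.univ_val_map]

theorem tupleSym_eq_iff {α : Type*} (n : ℕ) (f h : Fin n → α) :
    tupleSym n f = tupleSym n h ↔ ∃ σ : Equiv.Perm (Fin n), ∀ i, f (σ i) = h i := by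
  classical
  constructor
  · intro e
    have e' : Multiset.map f Finset.univ.val = Multiset.map h Finset.univ.val :=
      congrArg Subtype.val e
    have hc : ∀ b : α, Nonempty ({i // h i = b} ≃ {i // f i = b}) := by
      intro b
      have hb := congrArg (Multiset.count b) e'
      rw [Multiset.count_map, Multiset.count_map] at hb
      refine ⟨Fintype.equivOfCardEq ?_⟩
      rw [Fintype.card_subtype, Fintype.card_subtype]
      simp only [eq_comm (a := b)] at hb
      exact hb.symm
    let E : ∀ b : α, {i // h i = b} ≃ {i // f i = b} := fun b => (hc b).some
    refine ⟨(Equiv.sigmaFiberEquiv h).symm.trans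
      ((Equiv.sigmaCongrRight E).trans (Equiv.sigmaFiberEquiv f)), fun i => ?_⟩
    exact (E (h i) ⟨i, rfl⟩).2
  · rintro ⟨σ, hσ⟩
    apply Subtype.ext
    show Multiset.map f Finset.univ.val = Multiset.map h Finset.univ.val
    have : h = f ∘ σ := funext fun i => (hσ i).symm
    rw [this, ← Multiset.map_map, ← Finset.map_univ_equiv σ]
    simp

/-!
STATEMENT 13: The quotient of the function type `Fin g × Fin k → X` by the action of the
wreath product `S_g ≀ S_k` (acting through `Φ` by `w • F = F ∘ Φ(w)⁻¹`) is in bijection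
with `Sym (Sym X g) k`, the `k`-th symmetric power of the `g`-th symmetric power of `X`.
-/

theorem quotient_by_wreath_equiv_iterated_sym (X : Type*) (g k : ℕ) :
    Nonempty
      (Quotient (@MulAction.orbitRel (WreathProduct (Equiv.Perm (Fin g)) k)
        (Fin g × Fin k → X) _ (wreathArrowAction X g k)) ≃ Sym (Sym X g) k) := by
  let Ψ : (Fin g × Fin k → X) → Sym (Sym X g) k := fun F =>
    tupleSym k fun i => tupleSym g fun a => F (a, i)
  letI := wreathArrowAction X g k
  have key : ∀ F F' : Fin g × Fin k → X,
      MulAction.orbitRel (WreathProduct (Equiv.Perm (Fin g)) k) (Fin g × Fin k → X) F F' ↔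
        Ψ F = Ψ F' := by
    intro F F'
    rw [MulAction.orbitRel_apply, eq_comm, tupleSym_eq_iff]
    constructor
    · rintro ⟨w, rfl⟩
      refine ⟨w.right⁻¹, fun i => (tupleSym_eq_iff _ _ _).2 ⟨(w.left i)⁻¹, fun a => rfl⟩⟩
    · rintro ⟨τ, hτ⟩
      choose σ hσ using fun i => (tupleSym_eq_iff _ _ _).1 (hτ i)
      refine ⟨⟨fun i => (σ i)⁻¹, τ⁻¹⟩, ?_⟩
      funext p
      rw [← hσ p.2 p.1]
      rfl
  refine ⟨Equiv.ofBijective (Quotient.lift Ψ fun F F' h => (key F F').1 h) ⟨?_, ?_⟩⟩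
  · intro x y
    induction x using Quotient.inductionOn
    induction y using Quotient.inductionOn
    intro h
    exact Quotient.sound ((key _ _).2 h)
  · intro s
    obtain ⟨t, rfl⟩ := tupleSym_surjective k s
    choose u hu using fun i => tupleSym_surjective g (t i)
    refine ⟨Quotient.mk _ fun p => u p.2 p.1, ?_⟩
    show tupleSym k (fun i => tupleSym g (u i)) = _
    simp only [hu]
end
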